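/- Distributional Fourier transform of |x|^α for −1 < α < 0: Let α ∈ (−1, 0) and let φ : ℝ → ℂ be a Schwartz function with Fourier transform φ̂(k) = ∫_ℝ φ(x)e^{−ikx}dx. Then both integrals below converge absolutely and ∫_ℝ |x|^α · φ̂(x) dx = −2·Γ(α+1)·sin(πα/2) · ∫_ℝ |x|^{−α−1} · φ(x) dx. (In particular, for α = −1/2 the weight |x|^{−1/2} is reproduced up to the factor √(2π).) -/

import Mathlib

open MeasureTheory Real

/-- The Fourier transform `φ̂(k) = ∫ φ(x) e^{−ikx} dx` of a Schwartz function. -/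
noncomputable def fourierT (φ : SchwartzMap ℝ ℂ) (k : ℝ) : ℂ :=
  ∫ x : ℝ, φ x * Complex.exp (-Complex.I * (k : ℂ) * (x : ℂ))

theorem intervalIntegrable_abs_rpow {β : ℝ} (hβ : -1 < β) :
    IntervalIntegrable (fun x : ℝ => |x| ^ β) volume (-1) 1 := by
  have hpos : IntervalIntegrable (fun x : ℝ => |x| ^ β) volume 0 1 := by
    refine (intervalIntegral.intervalIntegrable_rpow' hβ).congr fun x hx => ?_
    rw [Set.uIoc_of_le zero_le_one] at hx
    simp only [abs_of_pos hx.1]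
  have hneg : IntervalIntegrable (fun x : ℝ => |x| ^ β) volume (-1) 0 := by
    simpa using! (hpos.comp_mul_left (c := -1)).symm
  exact hneg.trans hpos

/-- For `-1 < β ≤ 0`, multiplication by `|x| ^ β` preserves integrability of bounded functions. -/
theorem MeasureTheory.Integrable.abs_rpow_mul {f : ℝ → ℂ} (hf : Integrable f) {C : ℝ}
    (hC : ∀ x, ‖f x‖ ≤ C) {β : ℝ} (hβ : -1 < β) (hβ0 : β ≤ 0) :
    Integrable (fun x : ℝ => ((|x| ^ β : ℝ) : ℂ) * f x) := by
  have hloc : Integrable ((Set.Ioc (-1 : ℝ) 1).indicator fun x : ℝ => |x| ^ β) :=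
    (((intervalIntegrable_iff_integrableOn_Ioc_of_le (by norm_num)).1
      (intervalIntegrable_abs_rpow hβ))).integrable_indicator measurableSet_Ioc
  refine ((hloc.mul_const C).add hf.norm).mono' ?_ (ae_of_all _ fun x => ?_)
  · have : Measurable fun x : ℝ => ((|x| ^ β : ℝ) : ℂ) := by fun_prop
    exact this.aestronglyMeasurable.mul hf.aestronglyMeasurable
  · have hx0 : 0 ≤ |x| ^ β := by positivity
    rw [norm_mul, Complex.norm_real, Real.norm_of_nonneg hx0, Pi.add_apply]
    by_cases hx : x ∈ Set.Ioc (-1 : ℝ) 1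
    · rw [Set.indicator_of_mem hx]
      have := mul_le_mul_of_nonneg_left (hC x) hx0
      linarith [norm_nonneg (f x)]
    · rw [Set.indicator_of_notMem hx, zero_mul, zero_add]
      have h1 : 1 ≤ |x| := by
        by_contra! h
        exact hx ⟨(abs_lt.1 h).1, (abs_lt.1 h).2.le⟩
      exact mul_le_of_le_one_left (norm_nonneg _) (Real.rpow_le_one_of_one_le_of_nonpos h1 hβ0)

theorem fourierT_eq_fourier (φ : SchwartzMap ℝ ℂ) (k : ℝ) :
    fourierT φ k = FourierTransform.fourier φ (k / (2 * π)) := by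
  rw [SchwartzMap.fourier_coe, Real.fourier_real_eq_integral_exp_smul, fourierT]
  refine integral_congr_ae (ae_of_all _ fun x => ?_)
  simp only [smul_eq_mul]
  rw [mul_comm]
  congr 2
  have : (π : ℂ) ≠ 0 := by exact_mod_cast pi_ne_zero
  push_cast
  field_simp

theorem integrable_fourierT (φ : SchwartzMap ℝ ℂ) : Integrable (fourierT φ) := by
  rw [funext (fourierT_eq_fourier φ)]
  exact (FourierTransform.fourier φ).integrable.comp_div (by positivity)

theorem SchwartzMap.exists_norm_le (φ : SchwartzMap ℝ ℂ) : ∃ C, ∀ x, ‖φ x‖ ≤ C :=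
  ⟨_, φ.toBoundedContinuousFunction.norm_coe_le_norm⟩

theorem exists_norm_fourierT_le (φ : SchwartzMap ℝ ℂ) : ∃ C, ∀ x, ‖fourierT φ x‖ ≤ C := by
  obtain ⟨C, hC⟩ := (FourierTransform.fourier φ).exists_norm_le
  exact ⟨C, fun x => fourierT_eq_fourier φ x ▸ hC _⟩

theorem integral_gaussian_mul_fourierT (φ : SchwartzMap ℝ ℂ) {t : ℝ} (ht : 0 < t) :
    ∫ x : ℝ, (rexp (-(x ^ 2 * t)) : ℂ) * fourierT φ x =
      (√π : ℂ) * ((t : ℂ) ^ (-(1 / 2) : ℂ) *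
        ∫ y : ℝ, (rexp (-(y ^ 2 * (4⁻¹ * t⁻¹))) : ℂ) * φ y) := by
  have hg : Integrable fun x : ℝ => (rexp (-(x ^ 2 * t)) : ℂ) := by
    have := (integrable_exp_neg_mul_sq ht).ofReal (𝕜 := ℂ)
    simpa [mul_comm] using! this
  have hprod : Integrable (Function.uncurry fun x y : ℝ => (rexp (-(x ^ 2 * t)) : ℂ) *
      (φ y * Complex.exp (-Complex.I * x * y))) (volume.prod volume) := by
    have := (hg.mul_prod φ.integrable (ν := volume)).mul_bdd (c := 1)
      (g := fun z : ℝ × ℝ => Complex.exp (-Complex.I * z.1 * z.2))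
      (by fun_prop) (ae_of_all _ fun z => by simp [Complex.norm_exp])
    simpa [Function.uncurry_def, mul_assoc] using! this
  have hconst : ((π / t : ℂ)) ^ (1 / 2 : ℂ) = (√π : ℂ) * (t : ℂ) ^ (-(1 / 2) : ℂ) := by
    have h1 : ((π / t : ℂ)) ^ (1 / 2 : ℂ) = (((π / t) ^ (1 / 2 : ℝ) : ℝ) : ℂ) := by
      rw [Complex.ofReal_cpow (by positivity)]; push_cast; rfl
    have h2 : (t : ℂ) ^ (-(1 / 2) : ℂ) = ((t ^ (-(1 / 2) : ℝ) : ℝ) : ℂ) := by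
      rw [Complex.ofReal_cpow ht.le]; push_cast; rfl
    rw [h1, h2, Real.div_rpow pi_pos.le ht.le, Real.sqrt_eq_rpow, Real.rpow_neg ht.le]
    push_cast; rfl
  calc
    _ = ∫ x : ℝ, ∫ y : ℝ, (rexp (-(x ^ 2 * t)) : ℂ) *
        (φ y * Complex.exp (-Complex.I * x * y)) := by
      simp only [fourierT, integral_const_mul]
    _ = ∫ y : ℝ, ∫ x : ℝ, (rexp (-(x ^ 2 * t)) : ℂ) *
        (φ y * Complex.exp (-Complex.I * x * y)) := integral_integral_swap hprod
    _ = ∫ y : ℝ, (√π : ℂ) * ((t : ℂ) ^ (-(1 / 2) : ℂ) *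
        ((rexp (-(y ^ 2 * (4⁻¹ * t⁻¹))) : ℂ) * φ y)) := by
      refine integral_congr_ae (ae_of_all _ fun y => ?_)
      have key := fourierIntegral_gaussian (b := t) (by simpa using ht) (-y : ℂ)
      rw [hconst] at key
      calc
        _ = ∫ x : ℝ, φ y * (Complex.exp (Complex.I * (-y) * x) *
            Complex.exp (-t * (x : ℂ) ^ 2)) := by
          refine integral_congr_ae (ae_of_all _ fun x => ?_)
          have h1 : -Complex.I * x * y = Complex.I * (-y) * x := by ring
          have h2 : ((rexp (-(x ^ 2 * t)) : ℝ) : ℂ) = Complex.exp (-t * (x : ℂ) ^ 2) := by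
            push_cast; congr 1; ring
          simp only [h1, h2]; ring
        _ = _ := by
          rw [integral_const_mul, key]
          have h2 : ((rexp (-(y ^ 2 * (4⁻¹ * t⁻¹))) : ℝ) : ℂ) =
              Complex.exp (-(-y : ℂ) ^ 2 / (4 * t)) := by
            push_cast; congr 1
            have : (t : ℂ) ≠ 0 := by exact_mod_cast ht.ne'
            field_simp
          simp only [h2]; ring
    _ = _ := by simp only [integral_const_mul]

theorem abs_rpow_neg_two_mul (x s : ℝ) : |x| ^ (-(2 * s)) = (1 / x ^ 2) ^ s := by
  rw [← sq_abs, one_div, Real.inv_rpow (by positivity), ← Real.rpow_natCast,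
    ← Real.rpow_mul (abs_nonneg x), ← Real.rpow_neg (abs_nonneg x)]
  norm_num

/-- The Mellin transform of the Gaussian averages of `f` is a power-weighted integral of `f`. -/
theorem mellin_integral_gaussian_mul {f : ℝ → ℂ} {s : ℝ} (hs : 0 < s)
    (hf : AEStronglyMeasurable f)
    (hfs : Integrable fun x : ℝ => ((|x| ^ (-(2 * s)) : ℝ) : ℂ) * f x) :
    mellin (fun t => ∫ x : ℝ, (rexp (-(x ^ 2 * t)) : ℂ) * f x) s =
      (Real.Gamma s : ℂ) * ∫ x : ℝ, ((|x| ^ (-(2 * s)) : ℝ) : ℂ) * f x := by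
  have hne : ∀ᵐ x : ℝ, x ≠ 0 := by simp [ae_iff]
  have hint (x : ℝ) (hx : x ≠ 0) : ∫ t in Set.Ioi (0 : ℝ), t ^ (s - 1) * rexp (-(x ^ 2 * t)) =
      |x| ^ (-(2 * s)) * Real.Gamma s := by
    rw [Real.integral_rpow_mul_exp_neg_mul_Ioi hs (by positivity), abs_rpow_neg_two_mul]
  have hmeas : AEStronglyMeasurable (Function.uncurry fun t x : ℝ =>
      ((t ^ (s - 1) * rexp (-(x ^ 2 * t)) : ℝ) : ℂ) * f x)
      ((volume.restrict (Set.Ioi 0)).prod volume) := by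
    have h : Measurable fun z : ℝ × ℝ => ((z.1 ^ (s - 1) * rexp (-(z.2 ^ 2 * z.1)) : ℝ) : ℂ) := by
      fun_prop
    exact h.aestronglyMeasurable.mul hf.comp_snd
  have hprod : Integrable (Function.uncurry fun t x : ℝ =>
      ((t ^ (s - 1) * rexp (-(x ^ 2 * t)) : ℝ) : ℂ) * f x)
      ((volume.restrict (Set.Ioi 0)).prod volume) := by
    rw [integrable_prod_iff' hmeas]
    constructor
    · filter_upwards [hne] with x hx
      have h : IntegrableOn (fun t : ℝ => t ^ (s - 1) * rexp (-(x ^ 2 * t))) (Set.Ioi 0) := by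
        refine Integrable.of_integral_ne_zero ?_
        rw [hint x hx]
        have := Real.Gamma_pos_of_pos hs
        positivity
      exact (h.ofReal (𝕜 := ℂ)).mul_const (f x)
    · refine (hfs.norm.const_mul (Real.Gamma s)).congr ?_
      filter_upwards [hne] with x hx
      have h : ∀ t ∈ Set.Ioi (0 : ℝ), ‖((t ^ (s - 1) * rexp (-(x ^ 2 * t)) : ℝ) : ℂ) * f x‖ =
          t ^ (s - 1) * rexp (-(x ^ 2 * t)) * ‖f x‖ := fun t ht => by
        have : 0 < t := ht
        rw [norm_mul, Complex.norm_real, Real.norm_of_nonneg (by positivity)]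
      simp only [Function.uncurry_apply_pair]
      rw [setIntegral_congr_fun measurableSet_Ioi h, integral_mul_const, hint x hx, norm_mul,
        Complex.norm_real, Real.norm_of_nonneg (by positivity)]
      ring
  calc
    _ = ∫ t in Set.Ioi (0 : ℝ), ∫ x : ℝ,
        ((t ^ (s - 1) * rexp (-(x ^ 2 * t)) : ℝ) : ℂ) * f x := by
      refine setIntegral_congr_fun measurableSet_Ioi fun t ht => ?_
      have h : (t : ℂ) ^ ((s : ℂ) - 1) = ((t ^ (s - 1) : ℝ) : ℂ) := by
        rw [Complex.ofReal_cpow (le_of_lt ht)]; push_cast; rfl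
      simp only [h, smul_eq_mul, ← integral_const_mul, Complex.ofReal_mul, mul_assoc]
    _ = ∫ x : ℝ, ∫ t in Set.Ioi (0 : ℝ),
        ((t ^ (s - 1) * rexp (-(x ^ 2 * t)) : ℝ) : ℂ) * f x := integral_integral_swap hprod
    _ = ∫ x : ℝ, (Real.Gamma s : ℂ) * (((|x| ^ (-(2 * s)) : ℝ) : ℂ) * f x) := by
      refine integral_congr_ae ?_
      filter_upwards [hne] with x hx
      rw [integral_mul_const, integral_complex_ofReal, hint x hx]
      push_cast
      ring
    _ = _ := integral_const_mul _ _

theorem Real.sqrt_pi_mul_rpow_mul_Gamma_half {α : ℝ} (hα : α ∈ Set.Ioo (-1 : ℝ) 0) :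
    √π * ((4⁻¹ : ℝ) ^ (-((α + 1) / 2)) * Real.Gamma ((α + 1) / 2)) =
      Real.Gamma (-α / 2) * (-2 * Real.Gamma (α + 1) * Real.sin (π * α / 2)) := by
  have hdup := Real.Gamma_mul_Gamma_add_half ((α + 1) / 2)
  have hrefl := Real.Gamma_mul_Gamma_one_sub (-α / 2)
  rw [show (α + 1) / 2 + 1 / 2 = 1 - -α / 2 by ring, show 2 * ((α + 1) / 2) = α + 1 by ring,
    show 1 - (α + 1) = -α by ring] at hdup
  have hsin : Real.sin (π * (-α / 2)) = -Real.sin (π * α / 2) := by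
    rw [← Real.sin_neg]; congr 1; ring
  have hsin0 : 0 < Real.sin (π * (-α / 2)) :=
    Real.sin_pos_of_pos_of_lt_pi (by nlinarith [pi_pos, hα.2]) (by nlinarith [pi_pos, hα.1])
  have hG : 0 < Real.Gamma (1 - -α / 2) := Real.Gamma_pos_of_pos (by linarith [hα.1])
  have hpow : (4⁻¹ : ℝ) ^ (-((α + 1) / 2)) = 2 * 2 ^ α := by
    rw [Real.inv_rpow (by norm_num), Real.rpow_neg (by norm_num), inv_inv,
      show (4 : ℝ) = 2 ^ (2 : ℝ) by norm_num, ← Real.rpow_mul (by norm_num),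
      show 2 * ((α + 1) / 2) = 1 + α by ring, Real.rpow_add (by norm_num), Real.rpow_one]
  have h2 : (2 : ℝ) ^ α * 2 ^ (-α) = 1 := by
    rw [← Real.rpow_add (by norm_num)]; simp
  have hπ : √π * √π = π := Real.mul_self_sqrt pi_pos.le
  rw [eq_div_iff hsin0.ne', hsin] at hrefl
  rw [hpow]
  refine mul_right_cancel₀ hG.ne' ?_
  linear_combination (2 * √π * 2 ^ α) * hdup - 2 * Real.Gamma (α + 1) * hrefl +
    2 * Real.Gamma (α + 1) * √π * √π * h2 + 2 * Real.Gamma (α + 1) * hπ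

/-- Distributional Fourier transform of `|x|^α` for `−1 < α < 0`:
`∫ |x|^α φ̂(x) dx = −2Γ(α+1) sin(πα/2) ∫ |x|^{−α−1} φ(x) dx`,
both integrals converging absolutely. -/
theorem fourier_transform_abs_fractional_power (α : ℝ) (hα : α ∈ Set.Ioo (-1 : ℝ) 0)
    (φ : SchwartzMap ℝ ℂ) :
    Integrable (fun x : ℝ => ((|x| ^ α : ℝ) : ℂ) * fourierT φ x) ∧
    Integrable (fun x : ℝ => ((|x| ^ (-α - 1) : ℝ) : ℂ) * φ x) ∧
    ∫ x : ℝ, ((|x| ^ α : ℝ) : ℂ) * fourierT φ x =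
      ((-2 * Real.Gamma (α + 1) * Real.sin (π * α / 2) : ℝ) : ℂ) *
        ∫ x : ℝ, ((|x| ^ (-α - 1) : ℝ) : ℂ) * φ x := by
  obtain ⟨C, hC⟩ := φ.exists_norm_le
  obtain ⟨D, hD⟩ := exists_norm_fourierT_le φ
  have hl := (integrable_fourierT φ).abs_rpow_mul hD hα.1 hα.2.le
  have hr := φ.integrable.abs_rpow_mul hC (β := -α - 1) (by linarith [hα.2]) (by linarith [hα.1])
  refine ⟨hl, hr, ?_⟩
  have hα' : α = -(2 * (-α / 2)) := by ring
  have hβ' : -α - 1 = -(2 * ((α + 1) / 2)) := by ring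
  have hs : 0 < -α / 2 := by linarith [hα.2]
  have hl' := mellin_integral_gaussian_mul hs (integrable_fourierT φ).aestronglyMeasurable
    (by rwa [← hα'])
  have hr' := mellin_integral_gaussian_mul (s := (α + 1) / 2) (by linarith [hα.1])
    φ.integrable.aestronglyMeasurable (by rwa [← hβ'])
  rw [← hα'] at hl'
  rw [← hβ'] at hr'
  have hswap : mellin (fun t => ∫ x : ℝ, (rexp (-(x ^ 2 * t)) : ℂ) * fourierT φ x)
      ((-α / 2 : ℝ) : ℂ) = (√π : ℂ) * (((4⁻¹ : ℝ) : ℂ) ^ (-(((α + 1) / 2 : ℝ) : ℂ)) *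
        mellin (fun t => ∫ x : ℝ, (rexp (-(x ^ 2 * t)) : ℂ) * φ x) (((α + 1) / 2 : ℝ) : ℂ)) := by
    set K : ℝ → ℂ := fun t => ∫ x : ℝ, (rexp (-(x ^ 2 * t)) : ℂ) * φ x with hK
    calc
      _ = mellin (fun t => (√π : ℂ) • ((t : ℂ) ^ (-(1 / 2) : ℂ) • K (4⁻¹ * t⁻¹)))
          ((-α / 2 : ℝ) : ℂ) := by
        refine setIntegral_congr_fun measurableSet_Ioi fun t ht => ?_
        simp only [integral_gaussian_mul_fourierT φ ht, smul_eq_mul, hK]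
      _ = _ := by
        rw [mellin_const_smul, mellin_cpow_smul, mellin_comp_inv (fun t => K (4⁻¹ * t)),
          mellin_comp_mul_left K _ (by norm_num : (0 : ℝ) < 4⁻¹),
          show -(((-α / 2 : ℝ) : ℂ) + -(1 / 2)) = (((α + 1) / 2 : ℝ) : ℂ) by push_cast; ring]
        rfl
  have hpow : ((4⁻¹ : ℝ) : ℂ) ^ (-(((α + 1) / 2 : ℝ) : ℂ)) =
      (((4⁻¹ : ℝ) ^ (-((α + 1) / 2)) : ℝ) : ℂ) := by
    rw [Complex.ofReal_cpow (by norm_num)]; push_cast; rfl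
  have hconst := congrArg (Complex.ofReal) (Real.sqrt_pi_mul_rpow_mul_Gamma_half hα)
  rw [Complex.ofReal_mul, Complex.ofReal_mul, Complex.ofReal_mul (Real.Gamma (-α / 2))] at hconst
  rw [hl', hr', hpow] at hswap
  have hG : (Real.Gamma (-α / 2) : ℂ) ≠ 0 := by
    exact_mod_cast (Real.Gamma_pos_of_pos hs).ne'
  refine mul_left_cancel₀ hG ?_
  rw [hswap, ← mul_assoc (Real.Gamma (-α / 2) : ℂ), ← hconst]
  ring
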